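/- For n = 2, consider the one-dimensional map φ(z) = σ(σ^{−1}(z) − η(z − 1/2)) on (0,1), where σ(z) = 1/(1 + e^{−z}). If z₁ ≠ z₂ ∈ (0,1) form a period-2 orbit of φ (i.e., φ(z₁) = z₂ and φ(z₂) = z₁), then z₁ + z₂ = 1, and each period-2 point x satisfies tanh^{−1}(2x − 1) = (η/8)(2x − 1); equivalently, for η ≥ 8 the two points of oscillation are given by x = (h^{−1}(η/8) + 1)/2, where h(v) = tanh^{−1}(v)/v and h^{−1} takes two values symmetric about zero (and such nonconstant solutions exist only when η/8 ≥ 1, since h(v) ≥ 1 for all v). -/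

import Mathlib

open Filter Topology

/-- The inverse hyperbolic tangent, `tanh⁻¹(v) = (1/2) ln((1+v)/(1-v))`. -/
noncomputable def artanh (v : ℝ) : ℝ := (1 / 2) * Real.log ((1 + v) / (1 - v))

/-- The logit inverts the logistic function. -/
theorem log_div_one_sub_of_eq_logistic {t z : ℝ} (h : 1 / (1 + Real.exp (-t)) = z) :
    Real.log (z / (1 - z)) = t := by
  have he := Real.exp_pos (-t)
  have hz : z / (1 - z) = Real.exp t := by
    have h1 : 1 - z = Real.exp (-t) / (1 + Real.exp (-t)) := by
      rw [← h]
      field_simp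
      ring
    rw [h1, ← h, ← inv_inv (Real.exp t), ← Real.exp_neg]
    field_simp
  rw [hz, Real.log_exp]

/-- The logit is injective on the open unit interval. -/
theorem injOn_log_div_one_sub :
    Set.InjOn (fun z : ℝ => Real.log (z / (1 - z))) (Set.Ioo 0 1) := by
  rintro x ⟨hx0, hx1⟩ y ⟨hy0, hy1⟩ h
  have hx : 0 < 1 - x := by linarith
  have hy : 0 < 1 - y := by linarith
  have h' := Real.log_injOn_pos (div_pos hx0 hx) (div_pos hy0 hy) h
  rw [div_eq_div_iff hx.ne' hy.ne'] at h'
  linarith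

theorem log_div_one_sub_one_sub (z : ℝ) :
    Real.log ((1 - z) / (1 - (1 - z))) = -Real.log (z / (1 - z)) := by
  rw [← Real.log_inv, inv_div, sub_sub_cancel]

theorem artanh_two_mul_sub_one (z : ℝ) :
    artanh (2 * z - 1) = (1 / 2) * Real.log (z / (1 - z)) := by
  have h : (1 + (2 * z - 1)) / (1 - (2 * z - 1)) = z / (1 - z) := by
    rw [show 1 + (2 * z - 1) = 2 * z by ring, show 1 - (2 * z - 1) = 2 * (1 - z) by ring,
      mul_div_mul_left _ _ two_ne_zero]
  rw [artanh, h]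

theorem le_artanh {v : ℝ} (h0 : 0 ≤ v) (h1 : v < 1) : v ≤ artanh v := by
  have hv : 0 < 1 - v := by linarith
  have h := Real.le_log_one_add_of_nonneg (x := 2 * v / (1 - v)) (by positivity)
  have e1 : 1 + 2 * v / (1 - v) = (1 + v) / (1 - v) := by
    field_simp
    ring
  have e2 : 2 * (2 * v / (1 - v)) / (2 * v / (1 - v) + 2) = 2 * v := by
    have e3 : 2 * v / (1 - v) + 2 = 2 / (1 - v) := by
      field_simp
      ring
    rw [e3]
    field_simp
  rw [e1, e2] at h
  rw [artanh]
  linarith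

/-- A solution `v ∈ (0,1)` of `tanh⁻¹(v) = c v` forces `1 ≤ c`. -/
theorem one_le_of_artanh_eq_mul {c v : ℝ} (h0 : 0 < v) (h1 : v < 1) (h : artanh v = c * v) :
    1 ≤ c :=
  le_of_mul_le_mul_right (by simpa [h] using le_artanh h0.le h1) h0

/-- (Period-2 points of the two-example toy map.)
If `z₁ ≠ z₂ ∈ (0,1)` form a period-2 orbit of `φ(z) = σ(σ⁻¹(z) - η(z - 1/2))`, then
`z₁ + z₂ = 1`, each period-2 point `x` satisfies `tanh⁻¹(2x-1) = (η/8)(2x-1)`, such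
points only exist when `η ≥ 8`, and the two points of oscillation are
`(u+1)/2` and `(-u+1)/2` where `u ≠ 0` solves `tanh⁻¹(u)/u = η/8`. -/
theorem toy_period_two_points
    (η : ℝ)
    (σ : ℝ → ℝ) (hσ : ∀ z, σ z = 1 / (1 + Real.exp (-z)))
    (φ : ℝ → ℝ)
    (hφ : ∀ z, φ z = σ (Real.log (z / (1 - z)) - η * (z - 1 / 2)))
    (z₁ z₂ : ℝ) (hz₁ : z₁ ∈ Set.Ioo (0 : ℝ) 1) (hz₂ : z₂ ∈ Set.Ioo (0 : ℝ) 1)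
    (hne : z₁ ≠ z₂) (h12 : φ z₁ = z₂) (h21 : φ z₂ = z₁) :
    z₁ + z₂ = 1 ∧
    artanh (2 * z₁ - 1) = (η / 8) * (2 * z₁ - 1) ∧
    artanh (2 * z₂ - 1) = (η / 8) * (2 * z₂ - 1) ∧
    8 ≤ η ∧
    ∃ u : ℝ, u ≠ 0 ∧ artanh u / u = η / 8 ∧
      z₁ = (u + 1) / 2 ∧ z₂ = (-u + 1) / 2 := by
  have e1 := log_div_one_sub_of_eq_logistic (by rw [← hσ, ← hφ, h12])
  have e2 := log_div_one_sub_of_eq_logistic (by rw [← hσ, ← hφ, h21])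
  have hη : η ≠ 0 := by
    rintro rfl
    exact hne (injOn_log_div_one_sub hz₁ hz₂ (by simpa using e1.symm))
  have hsum : z₁ + z₂ = 1 := by
    have h : η * (z₁ + z₂ - 1) = 0 := by linarith
    have := (mul_eq_zero.1 h).resolve_left hη
    linarith
  obtain rfl : z₂ = 1 - z₁ := by linarith
  rw [log_div_one_sub_one_sub] at e1
  have a1 : artanh (2 * z₁ - 1) = (η / 8) * (2 * z₁ - 1) := by
    rw [artanh_two_mul_sub_one]
    linarith
  have a2 : artanh (2 * (1 - z₁) - 1) = (η / 8) * (2 * (1 - z₁) - 1) := by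
    rw [artanh_two_mul_sub_one, log_div_one_sub_one_sub]
    linarith
  have hu : 2 * z₁ - 1 ≠ 0 := fun h => hne (by linarith)
  obtain ⟨hz0, hz1⟩ := hz₁
  have h8 : 1 ≤ η / 8 := by
    rcases hu.lt_or_gt with h | h
    · exact one_le_of_artanh_eq_mul (by linarith) (by linarith) a2
    · exact one_le_of_artanh_eq_mul h (by linarith) a1
  refine ⟨hsum, a1, a2, by linarith, 2 * z₁ - 1, hu, ?_, by ring, by ring⟩
  rw [a1, mul_div_cancel_right₀ _ hu]
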